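/- arXiv:0809.1828 — 2 statements merged into one kernel-verified Lean document; each statement's English description precedes it below -/
import Mathlib

section
/- Let P be a partial order on a finite type and M a module of P. If (L₁, L₂) is a diametral pair of linear extensions of P, then the restrictions of L₁ and L₂ to M form a diametral pair of linear extensions of the partial order induced on M. -/
/-- `L` is a linear extension of the partial order `P`. -/
def IsLinExt {α : Type*} (P : PartialOrder α) (L : LinearOrder α) : Prop :=
  ∀ x y : α, P.le x y → L.le x y

/-- The distance between two linear orders: the number of ordered pairs `(x, y)` with
`x < y` in `L₁` and `y < x` in `L₂`. -/
noncomputable def leDist {α : Type*} (L₁ L₂ : LinearOrder α) : ℕ :=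
  Set.ncard {p : α × α | L₁.lt p.1 p.2 ∧ L₂.lt p.2 p.1}

/-- `(L₁, L₂)` is a diametral pair of linear extensions of `P`. -/
def IsDiametralPair {α : Type*} (P : PartialOrder α) (L₁ L₂ : LinearOrder α) : Prop :=
  IsLinExt P L₁ ∧ IsLinExt P L₂ ∧
    ∀ M₁ M₂ : LinearOrder α, IsLinExt P M₁ → IsLinExt P M₂ →
      leDist M₁ M₂ ≤ leDist L₁ L₂

/-- A linear extension is diametral if it belongs to some diametral pair. -/
def IsDiametral {α : Type*} (P : PartialOrder α) (L : LinearOrder α) : Prop :=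
  ∃ L' : LinearOrder α, IsDiametralPair P L L' ∨ IsDiametralPair P L' L

/-- The linear extension diameter of `P`. -/
noncomputable def led {α : Type*} (P : PartialOrder α) : ℕ :=
  sSup {d : ℕ | ∃ L₁ L₂ : LinearOrder α, IsLinExt P L₁ ∧ IsLinExt P L₂ ∧ leDist L₁ L₂ = d}

/-- `(u, v)` is a critical pair of `P`. -/
def IsCriticalPair {α : Type*} (P : PartialOrder α) (u v : α) : Prop :=
  ¬ P.le u v ∧ ¬ P.le v u ∧ (∀ z, P.lt z u → P.lt z v) ∧ (∀ z, P.lt v z → P.lt u z)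

/-- `L` reverses some critical pair of `P`. -/
def Reverses {α : Type*} (P : PartialOrder α) (L : LinearOrder α) : Prop :=
  ∃ u v : α, IsCriticalPair P u v ∧ L.lt v u

/-- `P` is diametrally reversing: every diametral linear extension reverses a critical pair. -/
def DiametrallyReversing {α : Type*} (P : PartialOrder α) : Prop :=
  ∀ L : LinearOrder α, IsDiametral P L → Reverses P L

/-- `M` is a module of `P`. -/
def IsModuleOf {α : Type*} (P : PartialOrder α) (M : Set α) : Prop :=
  ∀ x, x ∉ M →
    (∀ m ∈ M, P.lt x m) ∨ (∀ m ∈ M, P.lt m x) ∨ (∀ m ∈ M, ¬ P.le x m ∧ ¬ P.le m x)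

/-- `P` is a chain: any two elements are comparable. -/
def IsChainOrder {α : Type*} (P : PartialOrder α) : Prop :=
  ∀ x y : α, P.le x y ∨ P.le y x

/-- The partial order induced on a subset `M`. -/
def inducedOrder {α : Type*} (P : PartialOrder α) (M : Set α) : PartialOrder M :=
  letI := P
  PartialOrder.lift (fun a : M => (a : α)) Subtype.val_injective

/-- The restriction of a linear order `L` to a subset `M`. -/
def restrictLin {α : Type*} (L : LinearOrder α) (M : Set α) : LinearOrder M :=
  letI := L
  LinearOrder.lift' (fun a : M => (a : α)) Subtype.val_injective

open Classical in
/-- The indicator of the pair `(x, y)` being counted by `leDist L₁ L₂`. -/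
noncomputable def revInd {α : Type*} (L₁ L₂ : LinearOrder α) (x y : α) : ℕ :=
  if L₁.lt x y ∧ L₂.lt y x then 1 else 0

theorem leDist_eq_sum {α : Type*} [Fintype α] (L₁ L₂ : LinearOrder α) :
    leDist L₁ L₂ = ∑ x, ∑ y, revInd L₁ L₂ x y := by
  classical
  rw [← Fintype.sum_prod_type' (f := revInd L₁ L₂)]
  simp only [leDist, revInd]
  rw [Finset.sum_boole, Set.ncard_eq_toFinset_card', Set.toFinset_ofPred]
  rfl

theorem revInd_congr {α : Type*} {L₁ L₂ N₁ N₂ : LinearOrder α} {x y x' y' : α}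
    (h₁ : N₁.lt x y ↔ L₁.lt x' y') (h₂ : N₂.lt y x ↔ L₂.lt y' x') :
    revInd L₁ L₂ x' y' = revInd N₁ N₂ x y := by
  have h := and_congr h₁ h₂
  unfold revInd
  split_ifs <;> first | rfl | tauto

open Classical in
/-- Splitting the distance of two linear orders along a subset `M`. -/
theorem leDist_eq_restrict_add {α : Type*} [Fintype α] (L₁ L₂ : LinearOrder α) (M : Set α) :
    leDist L₁ L₂ = leDist (restrictLin L₁ M) (restrictLin L₂ M)
      + ∑ m : M, ∑ x : {x // x ∉ M}, (revInd L₁ L₂ m x + revInd L₁ L₂ x m)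
      + ∑ x : {x // x ∉ M}, ∑ y : {x // x ∉ M}, revInd L₁ L₂ x y := by
  have split (f : α → ℕ) : ∑ x, f x = ∑ x : M, f x + ∑ x : {x // x ∉ M}, f x :=
    (Fintype.sum_subtype_add_sum_subtype (· ∈ M) f).symm
  have hr : leDist (restrictLin L₁ M) (restrictLin L₂ M)
      = ∑ m : M, ∑ n : M, revInd L₁ L₂ m n := leDist_eq_sum _ _
  rw [leDist_eq_sum, hr, split]
  simp only [split (fun y => revInd L₁ L₂ _ y), Finset.sum_add_distrib]
  rw [Finset.sum_comm (f := fun (m : M) (x : {x // x ∉ M}) => revInd L₁ L₂ x m)]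
  ring

theorem LinearOrder.lift'_lt_iff {α β : Type*} [LinearOrder β] (f : α → β)
    (hf : Function.Injective f) (x y : α) : (LinearOrder.lift' f hf).lt x y ↔ f x < f y :=
  Iff.rfl

/-- Replacing `M` in the linear order `L` by a block, ordered by `K`, at the place of `a ∈ M`. -/
theorem exists_substitute {α : Type*} (L : LinearOrder α) (M : Set α) (K : LinearOrder M)
    (a : M) : ∃ N : LinearOrder α, restrictLin N M = K ∧
      (∀ m : M, ∀ x, x ∉ M → ((N.lt m x ↔ L.lt a x) ∧ (N.lt x m ↔ L.lt x a))) ∧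
      (∀ x y, x ∉ M → y ∉ M → (N.lt x y ↔ L.lt x y)) := by
  classical
  let f (x : α) : α ×ₗ M := if h : x ∈ M then toLex (a.1, ⟨x, h⟩) else toLex (x, a)
  have hfM (m : M) : f m = toLex (a.1, m) := dif_pos m.2
  have hfN (x : α) (h : x ∉ M) : f x = toLex (x, a) := dif_neg h
  have hne (x : α) (h : x ∉ M) : x ≠ a.1 := fun e => h (e ▸ a.2)
  have hf : Function.Injective f := by
    intro x y hxy
    by_cases hx : x ∈ M <;> by_cases hy : y ∈ M
    · simpa [f, hx, hy] using hxy
    · simp [f, hx, hy] at hxy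
      exact absurd hxy.1.symm (hne y hy)
    · simp [f, hx, hy] at hxy
      exact absurd hxy.1 (hne x hx)
    · simpa [f, hx, hy] using hxy
  refine ⟨LinearOrder.lift' f hf, ?_, fun m x hx => ⟨?_, ?_⟩, fun x y hx hy => ?_⟩
  · apply LinearOrder.ext_lt
    intro m n
    refine (LinearOrder.lift'_lt_iff f hf m n).trans ?_
    simp [hfM, Prod.Lex.toLex_lt_toLex]
  · refine (LinearOrder.lift'_lt_iff f hf m x).trans ?_
    simp [hfM, hfN x hx, Prod.Lex.toLex_lt_toLex, (hne x hx).symm]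
  · refine (LinearOrder.lift'_lt_iff f hf x m).trans ?_
    simp [hfM, hfN x hx, Prod.Lex.toLex_lt_toLex, hne x hx]
  · refine (LinearOrder.lift'_lt_iff f hf x y).trans ?_
    simp [hfN x hx, hfN y hy, Prod.Lex.toLex_lt_toLex]

theorem isLinExt_iff_lt {α : Type*} (P : PartialOrder α) (L : LinearOrder α) :
    IsLinExt P L ↔ ∀ x y, P.lt x y → L.lt x y := by
  constructor
  · intro h x y hxy
    exact @lt_of_le_of_ne α L.toPartialOrder x y (h x y (@le_of_lt α P.toPreorder x y hxy))
      (@ne_of_lt α P.toPreorder x y hxy)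
  · intro h x y hxy
    rcases @eq_or_lt_of_le α P x y hxy with rfl | hlt
    · exact L.le_refl x
    · exact @le_of_lt α L.toPreorder x y (h x y hlt)

theorem IsLinExt.restrict {α : Type*} {P : PartialOrder α} {L : LinearOrder α}
    (h : IsLinExt P L) (M : Set α) : IsLinExt (inducedOrder P M) (restrictLin L M) :=
  fun x y hxy => h x y hxy

/-- Substituting a linear extension for a module in a linear extension gives a linear
extension. -/
theorem IsLinExt.of_substitute {α : Type*} {P : PartialOrder α} {M : Set α}
    (hM : IsModuleOf P M) {L N : LinearOrder α} (hL : IsLinExt P L) (a : M)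
    (hNM : IsLinExt (inducedOrder P M) (restrictLin N M))
    (hcross : ∀ m : M, ∀ x, x ∉ M → ((N.lt m x ↔ L.lt a x) ∧ (N.lt x m ↔ L.lt x a)))
    (hout : ∀ x y, x ∉ M → y ∉ M → (N.lt x y ↔ L.lt x y)) : IsLinExt P N := by
  rw [isLinExt_iff_lt] at hL hNM ⊢
  intro x y hxy
  by_cases hx : x ∈ M <;> by_cases hy : y ∈ M
  · exact hNM ⟨x, hx⟩ ⟨y, hy⟩ hxy
  · refine (hcross ⟨x, hx⟩ y hy).1.2 (hL _ _ ?_)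
    rcases hM y hy with h | h | h
    · exact absurd (h x hx) (lt_asymm hxy)
    · exact h a a.2
    · exact absurd (le_of_lt hxy) (h x hx).2
  · refine (hcross ⟨y, hy⟩ x hx).2.2 (hL _ _ ?_)
    rcases hM x hx with h | h | h
    · exact h a a.2
    · exact absurd (h y hy) (lt_asymm hxy)
    · exact absurd (le_of_lt hxy) (h y hy).1
  · exact (hout x y hx hy).2 (hL x y hxy)

/-- Restricting a diametral pair of linear extensions of `P` to a module `M` yields a
diametral pair of linear extensions of the induced order on `M`. -/
theorem statement_7 {α : Type*} [Fintype α] (P : PartialOrder α) (M : Set α)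
    (hM : IsModuleOf P M) (L₁ L₂ : LinearOrder α) (h : IsDiametralPair P L₁ L₂) :
    IsDiametralPair (inducedOrder P M) (restrictLin L₁ M) (restrictLin L₂ M) := by
  classical
  obtain ⟨h₁, h₂, hmax⟩ := h
  refine ⟨h₁.restrict M, h₂.restrict M, fun K₁ K₂ hK₁ hK₂ => ?_⟩
  rcases isEmpty_or_nonempty M with hE | hE
  · simp [leDist_eq_sum]
  let r (m : M) : ℕ := ∑ x : {x // x ∉ M}, (revInd L₁ L₂ m x + revInd L₁ L₂ x m)
  obtain ⟨a, ha⟩ := Finite.exists_max r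
  obtain ⟨N₁, rfl, hc₁, ho₁⟩ := exists_substitute L₁ M K₁ a
  obtain ⟨N₂, rfl, hc₂, ho₂⟩ := exists_substitute L₂ M K₂ a
  have hle := hmax N₁ N₂ (h₁.of_substitute hM a hK₁ hc₁ ho₁) (h₂.of_substitute hM a hK₂ hc₂ ho₂)
  rw [leDist_eq_restrict_add N₁ N₂ M, leDist_eq_restrict_add L₁ L₂ M] at hle
  have hcross : ∑ m : M, r m ≤
      ∑ m : M, ∑ x : {x // x ∉ M}, (revInd N₁ N₂ m x + revInd N₁ N₂ x m) := by
    refine Finset.sum_le_sum fun m _ => (ha m).trans_eq (Finset.sum_congr rfl fun x _ => ?_)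
    obtain ⟨⟨h₁, h₁'⟩, h₂, h₂'⟩ := And.intro (hc₁ m x x.2) (hc₂ m x x.2)
    exact congrArg₂ (· + ·) (revInd_congr h₁ h₂') (revInd_congr h₁' h₂)
  have hout : ∑ x : {x // x ∉ M}, ∑ y : {x // x ∉ M}, revInd N₁ N₂ x y
      = ∑ x : {x // x ∉ M}, ∑ y : {x // x ∉ M}, revInd L₁ L₂ x y := by
    refine Finset.sum_congr rfl fun x _ => Finset.sum_congr rfl fun y _ => ?_
    exact (revInd_congr (ho₁ x y x.2 y.2) (ho₂ y x y.2 x.2)).symm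
  simp only [r] at hcross
  lia
end

section
/- Let P be a partial order on a finite type in which every chain has at most 2 elements (P has height at most 2), and suppose P is not a chain. Then P is diametrally reversing. -/
/-- The strict relation of a partial order, with the order as an explicit argument. -/
def PartialOrder.Before {α : Type*} (P : PartialOrder α) (x y : α) : Prop :=
  P.lt x y

/-- The strict relation of a linear order, with the order as an explicit argument. -/
def LinearOrder.Before {α : Type*} (L : LinearOrder α) (x y : α) : Prop :=
  L.lt x y

/-- `L` and `M` order the elements `x` and `y` differently. -/
def Disagree {α : Type*} (L M : LinearOrder α) (x y : α) : Prop :=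
  (L.Before x y ∧ M.Before y x) ∨ (L.Before y x ∧ M.Before x y)

theorem LinearOrder.before_trichotomy {α : Type*} (L : LinearOrder α) (x y : α) :
    L.Before x y ∨ x = y ∨ L.Before y x :=
  @_root_.lt_trichotomy α L x y

theorem LinearOrder.before_asymm {α : Type*} (L : LinearOrder α) {x y : α} (h : L.Before x y) :
    ¬ L.Before y x :=
  @_root_.lt_asymm α L.toPreorder x y h

theorem LinearOrder.before_irrefl {α : Type*} (L : LinearOrder α) (x : α) : ¬ L.Before x x :=
  @_root_.lt_irrefl α L.toPreorder x

theorem LinearOrder.before_trans {α : Type*} (L : LinearOrder α) {x y z : α}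
    (h : L.Before x y) (h' : L.Before y z) : L.Before x z :=
  @_root_.lt_trans α L.toPreorder x y z h h'

theorem isLinExt_iff_before {α : Type*} {P : PartialOrder α} {L : LinearOrder α} :
    IsLinExt P L ↔ ∀ x y : α, P.Before x y → L.Before x y := by
  constructor
  · intro h x y hxy
    have hne : x ≠ y := @ne_of_lt α P.toPreorder x y hxy
    exact @lt_of_le_of_ne α L.toPartialOrder x y
      (h x y (@le_of_lt α P.toPreorder x y hxy)) hne
  · intro h x y hxy
    rcases @eq_or_lt_of_le α P x y hxy with rfl | hlt
    · exact L.le_refl _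
    · exact @le_of_lt α L.toPreorder x y (h x y hlt)

theorem ncard_disagree {α : Type*} [Finite α] (L M : LinearOrder α) :
    Set.ncard {p : α × α | Disagree L M p.1 p.2} = 2 * leDist L M := by
  have hunion : {p : α × α | Disagree L M p.1 p.2} =
      {p : α × α | L.Before p.1 p.2 ∧ M.Before p.2 p.1} ∪
        Prod.swap '' {p : α × α | L.Before p.1 p.2 ∧ M.Before p.2 p.1} := by
    ext ⟨x, y⟩
    simp [Disagree]
  have hdist : leDist L M = {p : α × α | L.Before p.1 p.2 ∧ M.Before p.2 p.1}.ncard := rfl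
  rw [hunion, hdist, two_mul, Set.ncard_union_eq,
    Set.ncard_image_of_injective _ Prod.swap_injective]
  rw [Set.disjoint_left]
  rintro ⟨x, y⟩ ⟨h, -⟩ ⟨⟨z, w⟩, ⟨h', -⟩, he⟩
  simp only [Prod.swap_prod_mk, Prod.mk.injEq] at he
  obtain ⟨rfl, rfl⟩ := he
  exact L.before_asymm h h'

theorem leDist_comm {α : Type*} [Finite α] (L M : LinearOrder α) :
    leDist L M = leDist M L := by
  have h : {p : α × α | Disagree L M p.1 p.2} = {p : α × α | Disagree M L p.1 p.2} := by
    ext ⟨x, y⟩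
    simp only [Disagree, Set.mem_ofPred_eq]
    tauto
  have h₁ := ncard_disagree L M
  have h₂ := ncard_disagree M L
  rw [h] at h₁
  omega

theorem IsDiametralPair.symm {α : Type*} [Finite α] {P : PartialOrder α} {L M : LinearOrder α}
    (h : IsDiametralPair P L M) : IsDiametralPair P M L :=
  ⟨h.2.1, h.1, fun M₁ M₂ h₁ h₂ => leDist_comm L M ▸ h.2.2 M₁ M₂ h₁ h₂⟩

/-- A diametral pair has an inclusion-maximal set of disagreements. -/
theorem IsDiametralPair.disagree_of_disagree {α : Type*} [Finite α] {P : PartialOrder α}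
    {L M L' M' : LinearOrder α} (h : IsDiametralPair P L M)
    (hL : IsLinExt P L') (hM : IsLinExt P M')
    (hsub : ∀ x y, Disagree L M x y → Disagree L' M' x y) {x y : α}
    (hxy : Disagree L' M' x y) : Disagree L M x y := by
  have hle := h.2.2 L' M' hL hM
  have heq : {p : α × α | Disagree L M p.1 p.2} = {p : α × α | Disagree L' M' p.1 p.2} := by
    apply Set.eq_of_subset_of_ncard_le
    · exact fun p hp => hsub p.1 p.2 hp
    · rw [ncard_disagree, ncard_disagree]
      omega
    · exact Set.toFinite _
  have : (x, y) ∈ {p : α × α | Disagree L' M' p.1 p.2} := hxy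
  rwa [← heq] at this

/-- An element `x` of a linear order can be reinserted just below any given upper set `U`
of the remaining elements. -/
theorem exists_linearOrder_reinsert {α : Type*} (L : LinearOrder α) (x : α) (U : Set α)
    (hU : ∀ y z, y ≠ x → z ≠ x → L.Before y z → y ∈ U → z ∈ U) :
    ∃ L' : LinearOrder α, (∀ y z, y ≠ x → z ≠ x → (L'.Before y z ↔ L.Before y z)) ∧
      (∀ y, y ≠ x → (L'.Before x y ↔ y ∈ U)) ∧ (∀ y, y ≠ x → (L'.Before y x ↔ y ∉ U)) := by
  classical
  let r : α → α → Prop := fun y z =>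
    (y ≠ x ∧ z ≠ x ∧ L.Before y z) ∨ (y = x ∧ z ≠ x ∧ z ∈ U) ∨ (z = x ∧ y ≠ x ∧ y ∉ U)
  have htri := L.before_trichotomy
  have hirr := L.before_irrefl
  have htr : ∀ a b c, L.Before a b → L.Before b c → L.Before a c := fun a b c => L.before_trans
  have : Std.Irrefl r := ⟨by grind⟩
  have : IsTrans α r := ⟨by grind⟩
  have : Std.Trichotomous r := ⟨by grind⟩
  have : IsStrictTotalOrder α r := {}
  refine ⟨linearOrderOfSTO r, fun y z hy hz => ?_, fun y hy => ?_, fun y hy => ?_⟩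
  · change r y z ↔ _
    grind
  · change r x y ↔ _
    grind
  · change r y x ↔ _
    grind

/-- If an element `x` can be reinserted in both members of a diametral pair without losing a
disagreement, then no disagreement is gained. -/
theorem IsDiametralPair.disagree_of_reinsert {α : Type*} [Finite α] {P : PartialOrder α}
    {L M : LinearOrder α} (h : IsDiametralPair P L M) (x : α) (U V : Set α)
    (hU : ∀ y z, y ≠ x → z ≠ x → L.Before y z → y ∈ U → z ∈ U)
    (hV : ∀ y z, y ≠ x → z ≠ x → M.Before y z → y ∈ V → z ∈ V)
    (hsucc : ∀ y, P.Before x y → y ∈ U ∧ y ∈ V) (hpred : ∀ y, P.Before y x → y ∉ U ∧ y ∉ V)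
    (hsub : ∀ y, y ≠ x → Disagree L M x y → (y ∈ U ↔ y ∉ V))
    {y : α} (hy : y ≠ x) (hUV : y ∈ U ↔ y ∉ V) : Disagree L M x y := by
  obtain ⟨L', hL, hLx, hxL⟩ := exists_linearOrder_reinsert L x U hU
  obtain ⟨M', hM, hMx, hxM⟩ := exists_linearOrder_reinsert M x V hV
  have hLirr := L.before_irrefl
  have hPL := isLinExt_iff_before.1 h.1
  have hPM := isLinExt_iff_before.1 h.2.1
  refine h.disagree_of_disagree (L' := L') (M' := M') (isLinExt_iff_before.2 ?_)
    (isLinExt_iff_before.2 ?_) ?_ ?_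
  · intro a b hab
    by_cases ha : a = x <;> by_cases hb : b = x <;> grind
  · intro a b hab
    by_cases ha : a = x <;> by_cases hb : b = x <;> grind
  · unfold Disagree at *
    intro a b hab
    by_cases ha : a = x <;> by_cases hb : b = x <;> grind
  · unfold Disagree at *
    grind

/-- In a poset of height at most two, an element with a strict upper bound is minimal. -/
theorem not_lt_of_lt_of_ncard_chain_le_two {α : Type*} [Finite α] (P : PartialOrder α)
    (hh : ∀ C : Set α, IsChain P.le C → C.ncard ≤ 2) {x y z : α}
    (hyz : P.Before y z) : ¬ P.Before x y := by
  intro hxy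
  have hxz := @_root_.lt_trans α P.toPreorder x y z hxy hyz
  have hle : ∀ {a b}, P.Before a b → P.le a b := fun h => @_root_.le_of_lt α P.toPreorder _ _ h
  have hne : ∀ {a b}, P.Before a b → a ≠ b := fun h => @_root_.ne_of_lt α P.toPreorder _ _ h
  have hcard := hh {x, y, z} (by
    rintro a (rfl | rfl | rfl) b (rfl | rfl | rfl) hab <;>
      first
      | exact absurd rfl hab
      | exact Or.inl (hle (by assumption))
      | exact Or.inr (hle (by assumption)))
  rw [Set.ncard_eq_three.2 ⟨x, y, z, hne hxy, hne hxz, hne hyz, rfl⟩] at hcard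
  omega

theorem isCriticalPair_iff_before {α : Type*} {P : PartialOrder α} {u v : α} :
    IsCriticalPair P u v ↔ u ≠ v ∧ ¬ P.Before u v ∧ ¬ P.Before v u ∧
      (∀ z, P.Before z u → P.Before z v) ∧ (∀ z, P.Before v z → P.Before u z) := by
  have h : ∀ a b, P.le a b ↔ a = b ∨ P.Before a b := fun a b => @le_iff_eq_or_lt α P a b
  change (¬ P.le u v ∧ ¬ P.le v u ∧ (∀ z, P.Before z u → P.Before z v) ∧
    (∀ z, P.Before v z → P.Before u z)) ↔ _
  grind

/-- A nonempty finite set has a greatest element with respect to a given linear order. -/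
theorem LinearOrder.exists_last {α : Type*} [Finite α] (L : LinearOrder α) (A : Set α)
    (hA : A.Nonempty) : ∃ a ∈ A, ∀ y ∈ A, y ≠ a → L.Before y a := by
  obtain ⟨a, ha, hmax⟩ := @Set.exists_max_image α α L A id A.toFinite hA
  exact ⟨a, ha, fun y hy hne => @lt_of_le_of_ne α L.toPartialOrder y a (hmax y hy) hne⟩

/-- In a poset of height at most two which is not a chain, the first member of every diametral
pair reverses a critical pair. -/
theorem IsDiametralPair.reverses_of_height_le_two {α : Type*} [Finite α] {P : PartialOrder α}
    (hh : ∀ C : Set α, IsChain P.le C → C.ncard ≤ 2) (hchain : ¬ IsChainOrder P)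
    {L M : LinearOrder α} (h : IsDiametralPair P L M) : Reverses P L := by
  by_contra hrev
  have hmin : ∀ x y z, P.Before y z → ¬ P.Before x y :=
    fun x y z => not_lt_of_lt_of_ncard_chain_le_two P hh
  have hPL := isLinExt_iff_before.1 h.1
  have hPM := isLinExt_iff_before.1 h.2.1
  have hLtri := L.before_trichotomy
  have hLasymm : ∀ a b, L.Before a b → ¬ L.Before b a := fun a b => L.before_asymm
  have hMasymm : ∀ a b, M.Before a b → ¬ M.Before b a := fun a b => M.before_asymm
  have hMtrans : ∀ a b c, M.Before a b → M.Before b c → M.Before a c := fun a b c => M.before_trans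
  have hcrit : ∀ u v, u ≠ v → ¬ P.Before u v → ¬ P.Before v u → (∀ z, P.Before z u → P.Before z v) →
      (∀ z, P.Before v z → P.Before u z) → L.Before u v := by
    intro u v hne h₁ h₂ h₃ h₄
    rcases hLtri u v with h' | h' | h'
    · exact h'
    · exact absurd h' hne
    · exact absurd ⟨u, v, isCriticalPair_iff_before.2 ⟨hne, h₁, h₂, h₃, h₄⟩, h'⟩ hrev
  have htwin : ∀ u v, u ≠ v → (∀ z, ¬ P.Before u z) → (∀ z, ¬ P.Before v z) →
      ¬ ∀ z, P.Before z u ↔ P.Before z v := by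
    intro u v hne hu hv hz
    exact hLasymm u v (hcrit u v hne (hu v) (hv u) (fun z => (hz z).1) fun z hz => absurd hz (hv z))
      (hcrit v u hne.symm (hv u) (hu v) (fun z => (hz z).2) fun z hz => absurd hz (hu z))
  obtain ⟨u, v, huv, hltuv, hltvu⟩ : ∃ u v, u ≠ v ∧ ¬ P.Before u v ∧ ¬ P.Before v u := by
    have hle : ∀ a b, P.le a b ↔ a = b ∨ P.Before a b := fun a b => @le_iff_eq_or_lt α P a b
    unfold IsChainOrder at hchain
    grind
  obtain ⟨A, hA⟩ : ∃ A : Set α, ∀ x, x ∈ A ↔ ∃ y, P.Before x y :=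
    ⟨{x | ∃ y, P.Before x y}, fun _ => Iff.rfl⟩
  have hAB : ∀ a b, a ∈ A → b ∉ A → L.Before a b := by
    intro a b ha hb
    by_cases hab : P.Before a b
    · exact hPL a b hab
    · exact hcrit a b (by grind) hab (by grind) (by grind) (by grind)
  have hne : A.Nonempty := by
    by_contra hemp
    have hno : ∀ x y, ¬ P.Before x y := fun x y hxy => hemp ⟨x, (hA x).2 ⟨y, hxy⟩⟩
    exact htwin u v huv (hno u) (hno v) (by grind)
  obtain ⟨a, haA, ha⟩ := L.exists_last A hne
  obtain ⟨c, hcA, hc⟩ := M.exists_last A hne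
  have hab : ∀ b, b ∉ A → M.Before c b → P.Before a b := by
    intro b hb hcb
    by_contra hnab
    have hpred : ∀ y, P.Before y b → ¬ (y = a ∨ L.Before a y) := by
      intro y hyb
      have hya : y ≠ a := fun h => hnab (h ▸ hyb)
      have := hLasymm y a (ha y ((hA y).2 ⟨b, hyb⟩) hya)
      tauto
    have hagree : ∀ y, y ≠ b → Disagree L M b y → y = a ∨ L.Before a y := by
      intro y hyb hd
      by_cases hy : y ∈ A
      · have h₁ := hAB y b hy hb
        have h₂ : M.Before y b := by
          by_cases hyc : y = c
          · exact hyc ▸ hcb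
          · exact hMtrans y c b (hc y hy hyc) hcb
        unfold Disagree at hd
        grind
      · exact Or.inr (hAB a y haA hy)
    have := h.disagree_of_reinsert b {y | y = a ∨ L.Before a y} ∅ (by grind) (by grind)
      (by grind) (fun y hy => ⟨hpred y hy, Set.notMem_empty y⟩)
      (fun y hyb hd => iff_of_true (hagree y hyb hd) (Set.notMem_empty y))
      (y := a) (by grind) (by grind)
    unfold Disagree at this
    grind
  by_cases hac : a = c
  · subst hac
    have hsingle : ∀ y ∈ A, y = a := by
      intro y hy
      by_contra hya
      have := h.disagree_of_reinsert a Set.univ {y | M.Before a y} (by grind) (by grind)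
        (by grind) (by grind) (by unfold Disagree; grind) (y := y) hya (by grind)
      unfold Disagree at this
      grind
    have hisolated : ∀ x y, x ∉ A → ¬ P.Before a x → ¬ P.Before a y := by
      intro x y hx hax hay
      have hxsucc : ∀ z, ¬ P.Before x z := fun z hz => hx ((hA x).2 ⟨z, hz⟩)
      have hxpred : ∀ z, ¬ P.Before z x := fun z hz =>
        hax (hsingle z ((hA z).2 ⟨x, hz⟩) ▸ hz)
      have hd : ∀ z, z ≠ x → Disagree L M x z := fun z hz =>
        h.disagree_of_reinsert x ∅ Set.univ (by grind) (by grind)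
          (fun w hw => absurd hw (hxsucc w)) (fun w hw => absurd hw (hxpred w)) (by grind) hz
          (by grind)
      have hxa := hd a (by grind)
      have hxy := hd y (by grind)
      have := hcrit x y (by grind) (by grind) (by grind) (by grind) (by grind)
      unfold Disagree at hxa hxy
      grind
    obtain ⟨b, hb⟩ := (hA a).1 haA
    have hall : ∀ x, x ≠ a → P.Before a x := by grind
    exact htwin u v huv (by grind) (by grind) (by grind)
  · have := hcrit a c hac (by grind) (by grind) (by grind) (by grind)
    grind

/-- Every finite poset of height at most 2 (every chain has at most 2 elements) which
is not a chain is diametrally reversing. -/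
theorem statement_13 {α : Type*} [Fintype α] (P : PartialOrder α)
    (hh : ∀ C : Set α, IsChain P.le C → C.ncard ≤ 2)
    (hchain : ¬ IsChainOrder P) :
    DiametrallyReversing P := by
  rintro L ⟨M, h | h⟩
  · exact h.reverses_of_height_le_two hh hchain
  · exact h.symm.reverses_of_height_le_two hh hchain
end
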